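/- For d > 1 sufficiently close to 1 and C > 0, the curve E := sea-tangle comparison of Remark 8 fails: with α ⊆ ℝ³ the positive z-axis and β := {(x,y,z) ∈ ℝ³ : z³ = x² + y²}, the ratio vol(ST_d(α;C) ∩ B_ε(0)) / vol(ST_d(β;C) ∩ B_ε(0)) tends to 1 as ε → 0. -/

import Mathlib

open Filter Metric Topology MeasureTheory

noncomputable section

abbrev E (n : ℕ) := EuclideanSpace ℝ (Fin n)

/-- Direction set of `A` at the origin. -/
def Dir (n : ℕ) (A : Set (E n)) : Set (E n) :=
  {a | ‖a‖ = 1 ∧ ∃ x : ℕ → E n, (∀ i, x i ∈ A \ {0}) ∧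
    Tendsto x atTop (nhds (0 : E n)) ∧
    Tendsto (fun i => (‖x i‖)⁻¹ • x i) atTop (nhds a)}

/-- Sea-tangle neighbourhood of degree `d` and width `C`. -/
def STg (n : ℕ) (d C : ℝ) (A : Set (E n)) : Set (E n) :=
  {x | Metric.infDist x A ≤ C * ‖x‖ ^ d}

/-- Cone over the direction set (real tangent cone). -/
def LD (n : ℕ) (A : Set (E n)) : Set (E n) :=
  {x | ∃ a ∈ Dir n A, ∃ t : ℝ, 0 ≤ t ∧ x = t • a}

/-- Sequence selection property. -/
def SSP (n : ℕ) (S : Set (E n)) : Prop :=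
  ∀ a : ℕ → E n, (∀ m, a m ≠ 0) → Tendsto a atTop (nhds (0 : E n)) →
    (∃ L ∈ Dir n S, Tendsto (fun m => (‖a m‖)⁻¹ • a m) atTop (nhds L)) →
    ∀ ε > (0:ℝ), ∃ b : ℕ → E n, (∀ m, b m ∈ S) ∧
      ∀ᶠ m in atTop, ‖a m - b m‖ ≤ ε * min ‖a m‖ ‖b m‖

/-- ST-equivalence of set-germs at the origin. -/
def STEquiv (n : ℕ) (A B : Set (E n)) : Prop :=
  ∃ d₁ > (1:ℝ), ∃ C₁ > (0:ℝ), ∃ d₂ > (1:ℝ), ∃ C₂ > (0:ℝ), ∃ ε > (0:ℝ),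
    B ∩ ball (0 : E n) ε ⊆ STg n d₁ C₁ A ∧ A ∩ ball (0 : E n) ε ⊆ STg n d₂ C₂ B

/-- If every point `a` of the closed set `A ∋ 0` has a point of `B` within `‖a‖ ^ (3/2)`, then the
distance to `B` exceeds the distance to `A` by at most `(2 ‖x‖) ^ (3/2)`. -/
lemma infDist_le_infDist_add_sqrt {n : ℕ} {A B : Set (E n)} (hA : IsClosed A)
    (h0 : (0 : E n) ∈ A) (h : ∀ a ∈ A, ∃ b ∈ B, dist a b ≤ √(‖a‖ ^ 3)) (x : E n) :
    infDist x B ≤ infDist x A + √((2 * ‖x‖) ^ 3) := by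
  obtain ⟨a, ha, hxa⟩ := hA.exists_infDist_eq_dist ⟨0, h0⟩ x
  obtain ⟨b, hb, hab⟩ := h a ha
  have hle : dist x a ≤ ‖x‖ := by
    rw [← hxa, ← dist_zero_right x]
    exact infDist_le_dist_of_mem h0
  have hnorm : ‖a‖ ≤ 2 * ‖x‖ := by
    have := norm_le_norm_add_norm_sub' a x
    rw [norm_sub_rev, ← dist_eq_norm, dist_comm] at this
    rw [dist_comm] at hle
    linarith
  calc infDist x B ≤ dist x b := infDist_le_dist_of_mem hb
    _ ≤ dist x a + dist a b := dist_triangle _ _ _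
    _ ≤ infDist x A + √((2 * ‖x‖) ^ 3) := by
      rw [hxa]
      gcongr
      exact hab.trans (by gcongr)

/-- The closed positive `z`-axis. -/
def zRay : Set (E 3) := {x | x 0 = 0 ∧ x 1 = 0 ∧ 0 ≤ x 2}

/-- The surface `z ^ 3 = x ^ 2 + y ^ 2`. -/
def cuspSurface : Set (E 3) := {x | (x 2) ^ 3 = (x 0) ^ 2 + (x 1) ^ 2}

lemma zero_mem_zRay : (0 : E 3) ∈ zRay := by simp [zRay]

lemma zero_mem_cuspSurface : (0 : E 3) ∈ cuspSurface := by simp [cuspSurface]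

lemma isClosed_zRay : IsClosed zRay :=
  (isClosed_eq (by fun_prop) (by fun_prop)).inter
    ((isClosed_eq (by fun_prop) (by fun_prop)).inter
      (isClosed_le (f := fun _ : E 3 => (0 : ℝ)) (by fun_prop) (by fun_prop)))

lemma isClosed_cuspSurface : IsClosed cuspSurface :=
  isClosed_eq (by fun_prop) (by fun_prop)

lemma dist_eq_sqrt_coords (x y : E 3) :
    dist x y = √((x 0 - y 0) ^ 2 + (x 1 - y 1) ^ 2 + (x 2 - y 2) ^ 2) := by
  simp [EuclideanSpace.dist_eq, Fin.sum_univ_three, Real.dist_eq, sq_abs]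

lemma norm_sq_eq_coords (x : E 3) : ‖x‖ ^ 2 = (x 0) ^ 2 + (x 1) ^ 2 + (x 2) ^ 2 := by
  simp [EuclideanSpace.norm_sq_eq, Fin.sum_univ_three, sq_abs]

lemma infDist_zRay_le (x : E 3) :
    infDist x zRay ≤ infDist x cuspSurface + √((2 * ‖x‖) ^ 3) := by
  refine infDist_le_infDist_add_sqrt isClosed_cuspSurface zero_mem_cuspSurface
    (fun a ha => ?_) x
  have ha' : (a 2) ^ 3 = (a 0) ^ 2 + (a 1) ^ 2 := ha
  have h2 : 0 ≤ a 2 := by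
    by_contra! hneg
    have : (a 2) ^ 3 < 0 := Odd.pow_neg (by decide) hneg
    nlinarith [sq_nonneg (a 0), sq_nonneg (a 1)]
  refine ⟨!₂[0, 0, a 2], by simpa [zRay] using h2, ?_⟩
  rw [dist_eq_sqrt_coords]
  simp only [Matrix.cons_val, sub_zero, sub_self]
  have : a 2 ≤ ‖a‖ := (le_abs_self _).trans (PiLp.norm_apply_le a 2)
  rw [← ha']
  simp only [ne_eq, OfNat.ofNat_ne_zero, not_false_eq_true, zero_pow, add_zero]
  gcongr

lemma infDist_cuspSurface_le (x : E 3) :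
    infDist x cuspSurface ≤ infDist x zRay + √((2 * ‖x‖) ^ 3) := by
  refine infDist_le_infDist_add_sqrt isClosed_zRay zero_mem_zRay (fun a ha => ?_) x
  obtain ⟨h0, h1, h2⟩ := ha
  refine ⟨!₂[√((a 2) ^ 3), 0, a 2], ?_, ?_⟩
  · simp [cuspSurface, Real.sq_sqrt (pow_nonneg h2 3)]
  rw [dist_eq_sqrt_coords]
  have : a 2 ≤ ‖a‖ := (le_abs_self _).trans (PiLp.norm_apply_le a 2)
  simp only [Matrix.cons_val, sub_self, h0, h1, zero_sub, neg_sq,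
    Real.sq_sqrt (pow_nonneg h2 3)]
  simp only [ne_eq, OfNat.ofNat_ne_zero, not_false_eq_true, zero_pow, add_zero]
  gcongr

lemma sqrt_le_infDist_zRay (x : E 3) : √((x 0) ^ 2 + (x 1) ^ 2) ≤ infDist x zRay := by
  refine (le_infDist ⟨0, zero_mem_zRay⟩).2 fun {y} ⟨h0, h1, _⟩ => ?_
  rw [dist_eq_sqrt_coords, h0, h1]
  exact Real.sqrt_le_sqrt (by nlinarith [sq_nonneg (x 2 - y 2)])

lemma norm_le_infDist_zRay {x : E 3} (hx : x 2 ≤ 0) : ‖x‖ ≤ infDist x zRay := by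
  refine (le_infDist ⟨0, zero_mem_zRay⟩).2 fun {y} ⟨h0, h1, h2⟩ => ?_
  rw [dist_eq_sqrt_coords, h0, h1]
  refine Real.le_sqrt_of_sq_le ?_
  rw [norm_sq_eq_coords]
  nlinarith [mul_nonneg (neg_nonneg.2 hx) h2, sq_nonneg (y 2)]

lemma infDist_zRay_le_sqrt {x : E 3} (hx : 0 ≤ x 2) :
    infDist x zRay ≤ √((x 0) ^ 2 + (x 1) ^ 2) := by
  have hmem : (!₂[0, 0, x 2] : E 3) ∈ zRay := by simpa [zRay] using hx
  refine (infDist_le_dist_of_mem hmem).trans_eq ?_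
  rw [dist_eq_sqrt_coords]
  simp

/-- The map `(x, y, z) ↦ (s x, s y, z)`. -/
def horizontalScale (s : ℝ) : E 3 →ₗ[ℝ] E 3 := Matrix.toLpLin 2 2 (Matrix.diagonal ![s, s, 1])

lemma horizontalScale_zero (s : ℝ) (x : E 3) : horizontalScale s x 0 = s * x 0 := by
  simp [horizontalScale, Matrix.toLpLin_apply, Matrix.mulVec_diagonal]

lemma horizontalScale_one (s : ℝ) (x : E 3) : horizontalScale s x 1 = s * x 1 := by
  simp [horizontalScale, Matrix.toLpLin_apply, Matrix.mulVec_diagonal]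

lemma horizontalScale_two (s : ℝ) (x : E 3) : horizontalScale s x 2 = x 2 := by
  simp [horizontalScale, Matrix.toLpLin_apply, Matrix.mulVec_diagonal]

lemma det_horizontalScale (s : ℝ) : LinearMap.det (horizontalScale s) = s ^ 2 := by
  rw [horizontalScale, Matrix.toLpLin_eq_toLin, LinearMap.det_toLin, Matrix.det_diagonal]
  simp [Fin.prod_univ_three, sq]

lemma norm_horizontalScale_le {s : ℝ} (hs0 : 0 ≤ s) (hs1 : s ≤ 1) (x : E 3) :
    ‖horizontalScale s x‖ ≤ ‖x‖ := by
  refine le_of_sq_le_sq ?_ (norm_nonneg _)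
  rw [norm_sq_eq_coords, norm_sq_eq_coords, horizontalScale_zero, horizontalScale_one,
    horizontalScale_two, mul_pow, mul_pow]
  have : s ^ 2 ≤ 1 := pow_le_one₀ hs0 hs1
  nlinarith [sq_nonneg (x 0), sq_nonneg (x 1)]

lemma eventually_horn_bounds {C d s κ : ℝ} (hC : 0 < C) (hd : 1 < d) (hd' : d ≤ 5 / 4)
    (hκ0 : 0 < κ) (hκ1 : κ < 1) (hsκ : s < κ ^ d) :
    ∀ᶠ r in 𝓝[>] (0 : ℝ), C * r ^ d + √((2 * r) ^ 3) ≤ (1 - κ) * r ∧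
      s * (C * r ^ d + √((2 * r) ^ 3)) + √((2 * r) ^ 3) ≤ C * (κ * r) ^ d := by
  have hpow : ∀ p : ℝ, 0 < p → Tendsto (fun r : ℝ => r ^ p) (𝓝[>] 0) (𝓝 0) := fun p hp => by
    have := (Real.continuousAt_rpow_const 0 p (Or.inr hp.le)).tendsto
    rw [Real.zero_rpow hp.ne'] at this
    exact this.mono_left nhdsWithin_le_nhds
  have hv := hpow (d - 1) (by linarith)
  have hu := hpow (3 / 2 - d) (by linarith)
  have hlim₁ : Tendsto (fun r : ℝ => (C + √8 * r ^ (3 / 2 - d)) * r ^ (d - 1)) (𝓝[>] 0)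
      (𝓝 0) := by
    simpa using ((hu.const_mul √8).const_add C).mul hv
  have hlim₂ : Tendsto (fun r : ℝ => s * (C + √8 * r ^ (3 / 2 - d)) + √8 * r ^ (3 / 2 - d))
      (𝓝[>] 0) (𝓝 (s * C)) := by
    simpa using (((hu.const_mul √8).const_add C).const_mul s).add (hu.const_mul √8)
  have hlt : s * C < C * κ ^ d := by nlinarith
  filter_upwards [hlim₁.eventually_le_const (sub_pos.2 hκ1), hlim₂.eventually_le_const hlt,
    self_mem_nhdsWithin] with r h₁ h₂ hr
  have hr : 0 < r := hr
  have hsqrt : √((2 * r) ^ 3) = √8 * r ^ (3 / 2 - d) * r ^ d := by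
    rw [mul_assoc, ← Real.rpow_add hr, mul_pow, Real.sqrt_mul (by norm_num),
      Real.sqrt_eq_rpow (r ^ 3), ← Real.rpow_natCast, ← Real.rpow_natCast, ← Real.rpow_mul hr.le]
    norm_num
  have hrd : r ^ d = r ^ (d - 1) * r := by
    rw [← Real.rpow_add_one hr.ne', sub_add_cancel]
  have hrd0 : 0 < r ^ d := by positivity
  rw [hsqrt]
  constructor
  · calc C * r ^ d + √8 * r ^ (3 / 2 - d) * r ^ d
        = (C + √8 * r ^ (3 / 2 - d)) * r ^ (d - 1) * r := by
          rw [← add_mul, mul_assoc, ← hrd]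
      _ ≤ (1 - κ) * r := by gcongr
  · rw [Real.mul_rpow hκ0.le hr.le]
    nlinarith [mul_le_mul_of_nonneg_right h₂ hrd0.le]

lemma infDist_horizontalScale_le {C d s : ℝ} (hC : 0 < C) (hd : 1 < d) (hd' : d ≤ 5 / 4)
    (hs0 : 0 < s) (hs1 : s < 1) :
    ∀ᶠ ε in 𝓝[>] (0 : ℝ), ∀ x : E 3, ‖x‖ < ε →
      infDist x zRay ≤ C * ‖x‖ ^ d + √((2 * ‖x‖) ^ 3) →
      infDist (horizontalScale s x) zRay + √((2 * ‖horizontalScale s x‖) ^ 3)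
        ≤ C * ‖horizontalScale s x‖ ^ d := by
  obtain ⟨κ, hκ0, hκ1, hsκ⟩ : ∃ κ : ℝ, 0 < κ ∧ κ < 1 ∧ s < κ ^ d := by
    obtain ⟨t, hst, ht1⟩ := exists_between hs1
    have ht0 : 0 < t := hs0.trans hst
    refine ⟨t ^ d⁻¹, by positivity, Real.rpow_lt_one ht0.le ht1 (by positivity), ?_⟩
    rwa [Real.rpow_inv_rpow ht0.le (by positivity)]
  obtain ⟨ε₀, hε₀, hbound⟩ :=
    mem_nhdsGT_iff_exists_Ioo_subset.1 (eventually_horn_bounds hC hd hd' hκ0 hκ1 hsκ)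
  filter_upwards [Ioo_mem_nhdsGT hε₀] with ε hε x hxε hx
  rcases eq_or_ne x 0 with rfl | hx0
  · simp [infDist_zero_of_mem zero_mem_zRay, Real.zero_rpow (by positivity : d ≠ 0)]
  have hr : 0 < ‖x‖ := norm_pos_iff.2 hx0
  obtain ⟨h1, h2⟩ := hbound ⟨hr, hxε.trans hε.2⟩
  have hz : 0 ≤ x 2 := by
    by_contra! hneg
    have := norm_le_infDist_zRay hneg.le
    nlinarith
  set ρ := √((x 0) ^ 2 + (x 1) ^ 2) with hρ
  have hρle := (sqrt_le_infDist_zRay x).trans hx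
  rw [← hρ] at hρle
  have hρ0 : 0 ≤ ρ := Real.sqrt_nonneg _
  have hρsq : ρ ^ 2 = (x 0) ^ 2 + (x 1) ^ 2 := Real.sq_sqrt (by positivity)
  have hnz : ‖x‖ ≤ ρ + x 2 := by
    refine le_of_sq_le_sq ?_ (by positivity)
    rw [norm_sq_eq_coords]
    nlinarith [mul_nonneg hρ0 hz]
  have hzT : x 2 ≤ ‖horizontalScale s x‖ := by
    rw [← horizontalScale_two s x]
    exact (le_abs_self _).trans (PiLp.norm_apply_le (horizontalScale s x) 2)
  have hκT : κ * ‖x‖ ≤ ‖horizontalScale s x‖ := by linarith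
  have hTdist : infDist (horizontalScale s x) zRay ≤ s * ρ := by
    refine (infDist_zRay_le_sqrt (by rwa [horizontalScale_two])).trans_eq ?_
    rw [horizontalScale_zero, horizontalScale_one, mul_pow, mul_pow, ← mul_add,
      Real.sqrt_mul (sq_nonneg s), Real.sqrt_sq hs0.le]
  calc infDist (horizontalScale s x) zRay + √((2 * ‖horizontalScale s x‖) ^ 3)
      ≤ s * (C * ‖x‖ ^ d + √((2 * ‖x‖) ^ 3)) + √((2 * ‖x‖) ^ 3) := by
        have hT := norm_horizontalScale_le hs0.le hs1.le x
        gcongr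
        exact hTdist.trans (by gcongr)
    _ ≤ C * (κ * ‖x‖) ^ d := h2
    _ ≤ C * ‖horizontalScale s x‖ ^ d := by gcongr

/-- Any set containing the image of `A` under `horizontalScale s` has at least `s ^ 2` times the
volume of `A`. -/
lemma ofReal_sq_mul_volume_le {s : ℝ} {A B : Set (E 3)}
    (h : Set.MapsTo (horizontalScale s) A B) :
    ENNReal.ofReal (s ^ 2) * volume A ≤ volume B := by
  have := Measure.addHaar_image_linearMap (volume : Measure (E 3)) (horizontalScale s) A
  rw [det_horizontalScale, abs_of_nonneg (sq_nonneg s)] at this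
  rw [← this]
  exact measure_mono h.image_subset

lemma eventually_volume_le {C d s : ℝ} (hC : 0 < C) (hd : 1 < d) (hd' : d ≤ 5 / 4)
    (hs0 : 0 < s) (hs1 : s < 1) :
    ∀ᶠ ε in 𝓝[>] (0 : ℝ),
      ENNReal.ofReal (s ^ 2) * volume (STg 3 d C zRay ∩ ball 0 ε)
        ≤ volume (STg 3 d C cuspSurface ∩ ball 0 ε) ∧
      ENNReal.ofReal (s ^ 2) * volume (STg 3 d C cuspSurface ∩ ball 0 ε)
        ≤ volume (STg 3 d C zRay ∩ ball 0 ε) := by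
  filter_upwards [infDist_horizontalScale_le hC hd hd' hs0 hs1] with ε h
  have hball : ∀ x ∈ ball (0 : E 3) ε, horizontalScale s x ∈ ball (0 : E 3) ε := by
    intro x hx
    rw [mem_ball_zero_iff] at hx ⊢
    exact (norm_horizontalScale_le hs0.le hs1.le x).trans_lt hx
  constructor
  · refine ofReal_sq_mul_volume_le fun x hx => ⟨?_, hball x hx.2⟩
    have hx1 : infDist x zRay ≤ C * ‖x‖ ^ d := hx.1
    exact (infDist_cuspSurface_le _).trans
      (h x (mem_ball_zero_iff.1 hx.2) (hx1.trans (le_add_of_nonneg_right (Real.sqrt_nonneg _))))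
  · refine ofReal_sq_mul_volume_le fun x hx => ⟨?_, hball x hx.2⟩
    have hx1 : infDist x cuspSurface ≤ C * ‖x‖ ^ d := hx.1
    exact (le_add_of_nonneg_right (Real.sqrt_nonneg _)).trans
      (h x (mem_ball_zero_iff.1 hx.2) ((infDist_zRay_le x).trans (by gcongr)))

lemma volume_STg_zRay_inter_ball_ne_zero {C d ε : ℝ} (hC : 0 < C) (hd : 0 ≤ d) (hε : 0 < ε) :
    volume (STg 3 d C zRay ∩ ball 0 ε) ≠ 0 := by
  have hopen : IsOpen ({x : E 3 | infDist x zRay < C * ‖x‖ ^ d} ∩ ball 0 ε) := by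
    refine (isOpen_lt (continuous_infDist_pt _) ?_).inter isOpen_ball
    exact continuous_const.mul (continuous_norm.rpow_const fun _ => Or.inr hd)
  have hnorm : ‖EuclideanSpace.single (2 : Fin 3) (ε / 2)‖ = ε / 2 := by
    rw [PiLp.norm_single, Real.norm_of_nonneg (by positivity)]
  have hmem : EuclideanSpace.single (2 : Fin 3) (ε / 2) ∈ zRay := by
    simp [zRay, (half_pos hε).le]
  have hsub : {x : E 3 | infDist x zRay < C * ‖x‖ ^ d} ⊆ STg 3 d C zRay :=
    fun x (hx : infDist x zRay < C * ‖x‖ ^ d) => hx.le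
  refine ((hopen.measure_pos volume ⟨EuclideanSpace.single 2 (ε / 2), ?_, ?_⟩).trans_le
    (measure_mono (Set.inter_subset_inter_left _ hsub))).ne'
  · rw [Set.mem_ofPred_eq, infDist_zero_of_mem hmem, hnorm]
    positivity
  · rw [mem_ball_zero_iff, hnorm]
    linarith

/-- A ratio of `ℝ≥0∞`-valued functions tends to `1` as soon as each dominates `s ^ 2` times the
other eventually, for every `s < 1`. -/
lemma tendsto_div_one_of_eventually_sq_mul_le {ι : Type*} {l : Filter ι} {f g : ι → ENNReal}
    (hf : ∀ᶠ i in l, f i ≠ 0) (hg' : ∀ i, g i ≠ ⊤)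
    (h : ∀ s : ℝ, 0 < s → s < 1 → ∀ᶠ i in l,
      ENNReal.ofReal (s ^ 2) * f i ≤ g i ∧ ENNReal.ofReal (s ^ 2) * g i ≤ f i) :
    Tendsto (fun i => f i / g i) l (𝓝 1) := by
  have hlim : Tendsto (fun s : ℝ => ENNReal.ofReal (s ^ 2)) (𝓝[<] 1) (𝓝 1) := by
    have : Continuous fun s : ℝ => ENNReal.ofReal (s ^ 2) :=
      ENNReal.continuous_ofReal.comp (continuous_pow 2)
    simpa using (this.tendsto 1).mono_left nhdsWithin_le_nhds
  have hlim' : Tendsto (fun s : ℝ => (ENNReal.ofReal (s ^ 2))⁻¹) (𝓝[<] 1) (𝓝 1) := by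
    simpa using hlim.inv
  have hIoo : Set.Ioo (0 : ℝ) 1 ∈ 𝓝[<] (1 : ℝ) := Ioo_mem_nhdsLT one_pos
  have hg : ∀ᶠ i in l, g i ≠ 0 := by
    filter_upwards [hf, h (1 / 2) (by norm_num) (by norm_num)] with i hi hle h0
    rw [h0, nonpos_iff_eq_zero, mul_eq_zero] at hle
    exact hle.1.elim (by norm_num) hi
  refine tendsto_order.2 ⟨fun a ha => ?_, fun a ha => ?_⟩
  · obtain ⟨s, has, hs0, hs1⟩ := ((hlim.eventually_const_lt ha).and hIoo).exists
    filter_upwards [h s hs0 hs1, hg] with i hi hgi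
    exact has.trans_le ((ENNReal.le_div_iff_mul_le (Or.inl hgi) (Or.inl (hg' i))).2 hi.2)
  · obtain ⟨s, has, hs0, hs1⟩ := ((hlim'.eventually_lt_const ha).and hIoo).exists
    filter_upwards [h s hs0 hs1, hg] with i hi hgi
    refine lt_of_le_of_lt (ENNReal.div_le_of_le_mul ?_) has
    rw [← ENNReal.div_eq_inv_mul]
    refine (ENNReal.le_div_iff_mul_le (Or.inl ?_) (Or.inl ENNReal.ofReal_ne_top)).2 ?_
    · exact (ENNReal.ofReal_pos.2 (by positivity)).ne'
    · rw [mul_comm]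
      exact hi.1

theorem stmt16 (C : ℝ) (hC : 0 < C)
    (α β : Set (E 3))
    (hα : α = {x : E 3 | x 0 = 0 ∧ x 1 = 0 ∧ 0 ≤ x 2})
    (hβ : β = {x : E 3 | (x 2) ^ 3 = (x 0) ^ 2 + (x 1) ^ 2}) :
    ∃ d₀ > (1:ℝ), ∀ d : ℝ, 1 < d → d ≤ d₀ →
      Tendsto (fun ε : ℝ =>
          volume (STg 3 d C α ∩ ball (0 : E 3) ε) /
          volume (STg 3 d C β ∩ ball (0 : E 3) ε))
        (𝓝[>] (0:ℝ)) (nhds 1) := by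
  subst hα hβ
  refine ⟨5 / 4, by norm_num, fun d hd hd' => ?_⟩
  have hfin : ∀ (A : Set (E 3)) (ε : ℝ), volume (A ∩ ball 0 ε) ≠ ⊤ := fun A ε =>
    measure_ne_top_of_subset Set.inter_subset_right measure_ball_lt_top.ne
  refine tendsto_div_one_of_eventually_sq_mul_le ?_ (fun ε => hfin _ ε)
    fun s hs0 hs1 => eventually_volume_le hC hd hd' hs0 hs1
  filter_upwards [self_mem_nhdsWithin] with ε hε
  exact volume_STg_zRay_inter_ball_ne_zero hC (by linarith) hε
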